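/- With notation and hypotheses as in the context, B(e₁, e₃) = B(e₃, e₁) = ((−p)^k·λ𝔭̄/(εp+1))·c and B(e₂, e₃) = B(e₃, e₂) = ((−p)^k·λ𝔭/(εp+1))·c. -/

import Mathlib

open Matrix

/-- The matrix of the Hecke operator `U𝔭` in the basis
`[μ], υ𝔭*·[μ], υ𝔭̄*·[μ], υ𝔭*υ𝔭̄*·[μ]`. -/
noncomputable def Ufp (p k : ℕ) (lp : ℂ) : Matrix (Fin 4) (Fin 4) ℂ :=
  !![lp, (p : ℂ) ^ (k + 1), 0, 0;
     -1, 0, 0, 0;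
     0, 0, lp, (p : ℂ) ^ (k + 1);
     0, 0, -1, 0]

/-- The matrix of the Hecke operator `U𝔭̄` in the same basis. -/
noncomputable def Ufpb (p k : ℕ) (lpb : ℂ) : Matrix (Fin 4) (Fin 4) ℂ :=
  !![lpb, 0, (p : ℂ) ^ (k + 1), 0;
     0, lpb, 0, (p : ℂ) ^ (k + 1);
     -1, 0, 0, 0;
     0, -1, 0, 0]

/-- The matrix of the partial Atkin–Lehner operator `ω𝔭` (with `ε = (−1)^k`). -/
noncomputable def Wfp (p k : ℕ) : Matrix (Fin 4) (Fin 4) ℂ :=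
  !![0, (p : ℂ) ^ k, 0, 0;
     (-1 : ℂ) ^ k, 0, 0, 0;
     0, 0, 0, (p : ℂ) ^ k;
     0, 0, (-1 : ℂ) ^ k, 0]

/-- The matrix of the partial Atkin–Lehner operator `ω𝔭̄` (with `ε = (−1)^k`). -/
noncomputable def Wfpb (p k : ℕ) : Matrix (Fin 4) (Fin 4) ℂ :=
  !![0, 0, (p : ℂ) ^ k, 0;
     0, 0, 0, (p : ℂ) ^ k;
     (-1 : ℂ) ^ k, 0, 0, 0;
     0, (-1 : ℂ) ^ k, 0, 0]

/-- The Atkin–Lehner matrix `ω_p = ω𝔭·ω𝔭̄`. -/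
noncomputable def Wp (p k : ℕ) : Matrix (Fin 4) (Fin 4) ℂ := Wfp p k * Wfpb p k

/-- The adjoint `U𝔭* = ω_p⁻¹·U𝔭·ω_p`. -/
noncomputable def UfpStar (p k : ℕ) (lp : ℂ) : Matrix (Fin 4) (Fin 4) ℂ :=
  (Wp p k)⁻¹ * Ufp p k lp * Wp p k

/-- The adjoint `U𝔭̄* = ω_p⁻¹·U𝔭̄·ω_p`. -/
noncomputable def UfpbStar (p k : ℕ) (lpb : ℂ) : Matrix (Fin 4) (Fin 4) ℂ :=
  (Wp p k)⁻¹ * Ufpb p k lpb * Wp p k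

/-- The standard basis `e₀, e₁, e₂, e₃` of `ℂ⁴`. -/
noncomputable def e (i : Fin 4) : Fin 4 → ℂ := Pi.single i 1

theorem Wp_eq (p k : ℕ) :
    Wp p k = !![0, 0, 0, (p : ℂ) ^ k * (p : ℂ) ^ k;
                0, 0, (-1 : ℂ) ^ k * (p : ℂ) ^ k, 0;
                0, (-1 : ℂ) ^ k * (p : ℂ) ^ k, 0, 0;
                (-1 : ℂ) ^ k * (-1 : ℂ) ^ k, 0, 0, 0] := by
  ext i j
  fin_cases i <;> fin_cases j <;>
    simp [Wp, Wfp, Wfpb, Matrix.mul_apply, Fin.sum_univ_four, mul_comm]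

theorem neg_one_pow_mul_self (k : ℕ) : (-1 : ℂ) ^ k * (-1 : ℂ) ^ k = 1 := by
  rw [← mul_pow]; simp

theorem isUnit_det_Wp {p : ℕ} (hp : p ≠ 0) (k : ℕ) : IsUnit (Wp p k).det := by
  have hsq : Wp p k * Wp p k = ((p : ℂ) ^ k * (p : ℂ) ^ k) • (1 : Matrix (Fin 4) (Fin 4) ℂ) := by
    rw [Wp_eq]
    have hε := neg_one_pow_mul_self k
    ext i j
    fin_cases i <;> fin_cases j <;>
      simp [Matrix.mul_apply, Fin.sum_univ_four] <;> grind
  refine isUnit_iff_ne_zero.mpr fun h => ?_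
  have hdet := congrArg Matrix.det hsq
  rw [Matrix.det_mul, h, Matrix.det_smul] at hdet
  have hpow : ((p : ℂ) ^ k * (p : ℂ) ^ k) ^ 4 ≠ 0 := by positivity
  exact hpow (by simpa using hdet.symm)

theorem inv_mul_mul_eq_of_mul_eq {n R : Type*} [Fintype n] [DecidableEq n] [CommRing R]
    {W A X : Matrix n n R} (hW : IsUnit W.det) (h : W * X = A * W) : W⁻¹ * A * W = X := by
  rw [Matrix.mul_assoc, ← h, Matrix.nonsing_inv_mul_cancel_left _ _ hW]

theorem UfpStar_eq {p : ℕ} (hp : p ≠ 0) (k : ℕ) (l : ℂ) :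
    UfpStar p k l = !![0, -((-1 : ℂ) ^ k * (p : ℂ) ^ k), 0, 0;
                       (-1 : ℂ) ^ k * p, l, 0, 0;
                       0, 0, 0, -((-1 : ℂ) ^ k * (p : ℂ) ^ k);
                       0, 0, (-1 : ℂ) ^ k * p, l] := by
  refine inv_mul_mul_eq_of_mul_eq (isUnit_det_Wp hp k) ?_
  rw [Wp_eq, Ufp]
  have hε := neg_one_pow_mul_self k
  ext i j
  fin_cases i <;> fin_cases j <;>
    simp [Matrix.mul_apply, Fin.sum_univ_four, pow_succ] <;> grind

theorem UfpbStar_eq {p : ℕ} (hp : p ≠ 0) (k : ℕ) (l : ℂ) :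
    UfpbStar p k l = !![0, 0, -((-1 : ℂ) ^ k * (p : ℂ) ^ k), 0;
                        0, 0, 0, -((-1 : ℂ) ^ k * (p : ℂ) ^ k);
                        (-1 : ℂ) ^ k * p, 0, l, 0;
                        0, (-1 : ℂ) ^ k * p, 0, l] := by
  refine inv_mul_mul_eq_of_mul_eq (isUnit_det_Wp hp k) ?_
  rw [Wp_eq, Ufpb]
  have hε := neg_one_pow_mul_self k
  ext i j
  fin_cases i <;> fin_cases j <;>
    simp [Matrix.mul_apply, Fin.sum_univ_four, pow_succ] <;> grind

theorem Ufp_mulVec_e_zero (p k : ℕ) (l : ℂ) :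
    (Ufp p k l).mulVec (e 0) = l • e 0 + (-1 : ℂ) • e 1 := by
  ext i; fin_cases i <;> simp [Ufp, e]

theorem Ufp_mulVec_e_two (p k : ℕ) (l : ℂ) :
    (Ufp p k l).mulVec (e 2) = l • e 2 + (-1 : ℂ) • e 3 := by
  ext i; fin_cases i <;> simp [Ufp, e]

theorem Ufpb_mulVec_e_zero (p k : ℕ) (l : ℂ) :
    (Ufpb p k l).mulVec (e 0) = l • e 0 + (-1 : ℂ) • e 2 := by
  ext i; fin_cases i <;> simp [Ufpb, e]

theorem Ufpb_mulVec_e_one (p k : ℕ) (l : ℂ) :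
    (Ufpb p k l).mulVec (e 1) = l • e 1 + (-1 : ℂ) • e 3 := by
  ext i; fin_cases i <;> simp [Ufpb, e]

theorem UfpStar_mulVec_e_one {p : ℕ} (hp : p ≠ 0) (k : ℕ) (l : ℂ) :
    (UfpStar p k l).mulVec (e 1) = l • e 1 + (-((-1 : ℂ) ^ k * (p : ℂ) ^ k)) • e 0 := by
  rw [UfpStar_eq hp]
  ext i; fin_cases i <;> simp [e]

theorem UfpStar_mulVec_e_two {p : ℕ} (hp : p ≠ 0) (k : ℕ) (l : ℂ) :
    (UfpStar p k l).mulVec (e 2) = ((-1 : ℂ) ^ k * p) • e 3 := by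
  rw [UfpStar_eq hp]
  ext i; fin_cases i <;> simp [e]

theorem UfpbStar_mulVec_e_one {p : ℕ} (hp : p ≠ 0) (k : ℕ) (l : ℂ) :
    (UfpbStar p k l).mulVec (e 1) = ((-1 : ℂ) ^ k * p) • e 3 := by
  rw [UfpbStar_eq hp]
  ext i; fin_cases i <;> simp [e]

theorem UfpbStar_mulVec_e_two {p : ℕ} (hp : p ≠ 0) (k : ℕ) (l : ℂ) :
    (UfpbStar p k l).mulVec (e 2) = l • e 2 + (-((-1 : ℂ) ^ k * (p : ℂ) ^ k)) • e 0 := by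
  rw [UfpbStar_eq hp]
  ext i; fin_cases i <;> simp [e]

theorem eq_div_and_eq_div_of_symmetric_system {K : Type*} [Field K] {a t z w : K}
    (ht : t + 1 ≠ 0) (ht' : t - 1 ≠ 0) (h₁ : a - z = t * w) (h₂ : t * z = a - w) :
    w = a / (t + 1) ∧ z = a / (t + 1) := by
  have hwz : w = z := mul_left_cancel₀ ht' (by linear_combination -h₁ - h₂)
  subst hwz
  have hw : w = a / (t + 1) := by
    rw [eq_div_iff ht]; linear_combination -h₁
  exact ⟨hw, hw⟩

/-- Values of the twisted Poincaré pairing: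
`B(e₁,e₃) = B(e₃,e₁) = ((−p)^k·λ𝔭̄/(εp+1))·c` and
`B(e₂,e₃) = B(e₃,e₂) = ((−p)^k·λ𝔭/(εp+1))·c`, where `ε = (−1)^k`, `c = B(e₀,e₀)`. -/
theorem stmt_11 (p k : ℕ) (hp : p.Prime) (hp3 : 3 ≤ p) (lp lpb : ℝ)
    (B : (Fin 4 → ℂ) → (Fin 4 → ℂ) → ℂ)
    (haddl : ∀ x x' y, B (x + x') y = B x y + B x' y)
    (haddr : ∀ x y y', B x (y + y') = B x y + B x y')
    (hsmull : ∀ (a : ℂ) (x y : Fin 4 → ℂ), B (a • x) y = a * B x y)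
    (hsmulr : ∀ (a : ℂ) (x y : Fin 4 → ℂ), B x (a • y) = (starRingEnd ℂ) a * B x y)
    (hU : ∀ x y, B ((Ufp p k (lp : ℂ)).mulVec x) y = B x ((UfpStar p k (lp : ℂ)).mulVec y))
    (hUs : ∀ x y, B ((UfpStar p k (lp : ℂ)).mulVec x) y = B x ((Ufp p k (lp : ℂ)).mulVec y))
    (hV : ∀ x y, B ((Ufpb p k (lpb : ℂ)).mulVec x) y = B x ((UfpbStar p k (lpb : ℂ)).mulVec y))
    (hVs : ∀ x y, B ((UfpbStar p k (lpb : ℂ)).mulVec x) y = B x ((Ufpb p k (lpb : ℂ)).mulVec y))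
    :
    B (e 1) (e 3) =
      ((-(p : ℂ)) ^ k * (lpb : ℂ) / ((-1 : ℂ) ^ k * (p : ℂ) + 1)) * B (e 0) (e 0) ∧
    B (e 3) (e 1) =
      ((-(p : ℂ)) ^ k * (lpb : ℂ) / ((-1 : ℂ) ^ k * (p : ℂ) + 1)) * B (e 0) (e 0) ∧
    B (e 2) (e 3) =
      ((-(p : ℂ)) ^ k * (lp : ℂ) / ((-1 : ℂ) ^ k * (p : ℂ) + 1)) * B (e 0) (e 0) ∧
    B (e 3) (e 2) =
      ((-(p : ℂ)) ^ k * (lp : ℂ) / ((-1 : ℂ) ^ k * (p : ℂ) + 1)) * B (e 0) (e 0) := by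
  have hp0 : p ≠ 0 := hp.ne_zero
  have hε := neg_one_pow_mul_self k
  have hsq : ((-1 : ℂ) ^ k * p) ^ 2 ≠ 1 := by
    rw [mul_pow, sq, hε, one_mul]
    exact_mod_cast (by nlinarith : p ^ 2 ≠ 1)
  have ht : (-1 : ℂ) ^ k * p + 1 ≠ 0 := fun h =>
    hsq (by linear_combination ((-1 : ℂ) ^ k * p - 1) * h)
  have ht' : (-1 : ℂ) ^ k * p - 1 ≠ 0 := fun h =>
    hsq (by linear_combination ((-1 : ℂ) ^ k * p + 1) * h)
  have h11 := hU (e 0) (e 1)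
  have h22 := hV (e 0) (e 2)
  have hU22 := hU (e 2) (e 2)
  have hUs22 := hUs (e 2) (e 2)
  have hV11 := hV (e 1) (e 1)
  have hVs11 := hVs (e 1) (e 1)
  simp only [Ufp_mulVec_e_zero, Ufp_mulVec_e_two, Ufpb_mulVec_e_zero, Ufpb_mulVec_e_one,
    UfpStar_mulVec_e_one hp0, UfpStar_mulVec_e_two hp0, UfpbStar_mulVec_e_one hp0,
    UfpbStar_mulVec_e_two hp0, haddl, haddr, hsmull, hsmulr, map_mul, map_neg, map_pow, map_one,
    Complex.conj_ofReal, Complex.conj_natCast] at h11 h22 hU22 hUs22 hV11 hVs11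
  have hb11 : B (e 1) (e 1) = (-1 : ℂ) ^ k * (p : ℂ) ^ k * B (e 0) (e 0) := by
    linear_combination -h11
  have hb22 : B (e 2) (e 2) = (-1 : ℂ) ^ k * (p : ℂ) ^ k * B (e 0) (e 0) := by
    linear_combination -h22
  obtain ⟨h13, h31⟩ := eq_div_and_eq_div_of_symmetric_system (a := lpb * B (e 1) (e 1))
    (z := B (e 3) (e 1)) (w := B (e 1) (e 3)) ht ht'
    (by linear_combination hV11) (by linear_combination hVs11)
  obtain ⟨h23, h32⟩ := eq_div_and_eq_div_of_symmetric_system (a := lp * B (e 2) (e 2))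
    (z := B (e 3) (e 2)) (w := B (e 2) (e 3)) ht ht'
    (by linear_combination hU22) (by linear_combination hUs22)
  rw [h13, h31, h23, h32, hb11, hb22, neg_pow (p : ℂ) k]
  refine ⟨?_, ?_, ?_, ?_⟩ <;> ring
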